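/- arXiv:0907.1350 — 2 statements merged into one kernel-verified Lean document; each statement's English description precedes it below -/
import Mathlib

section
/- Let X be a simple graph on a vertex set V which is a tree, let a group G act on V by automorphisms of X, and let x₁, x₂ be adjacent vertices of X. For i = 1,2 let A_i be a finite subgroup of the stabiliser G_{x_i} such that (i) A_i acts transitively on the set of neighbours of x_i in X, and (ii) the stabiliser of x_{3-i} in A_i equals A₁ ∩ A₂. Let Γ be the subgroup of G generated by A₁ ∪ A₂. Then: the stabiliser of x_i in Γ equals A_i for i = 1,2; for every pair of adjacent vertices v, w of X there exists γ ∈ Γ with {γ•v, γ•w} = {x₁, x₂}; and the canonical homomorphism from the amalgamated free product A₁ *_{A₁∩A₂} A₂ to G induced by the two inclusions is injective with image Γ. -/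
/-- The family of the two vertex groups `A₁`, `A₂`, indexed by `Bool`
(`false ↦ A₁`, `true ↦ A₂`). -/
def amalgamFam {G : Type*} [Group G] (A₁ A₂ : Subgroup G) : Bool → Subgroup G :=
  fun b => Bool.rec A₁ A₂ b

/-- The two inclusion homomorphisms `A₁ ⊓ A₂ → A_i` along which the amalgam is formed. -/
def amalgamIncl {G : Type*} [Group G] (A₁ A₂ : Subgroup G) :
    ∀ b : Bool, (↥(A₁ ⊓ A₂) →* ↥(amalgamFam A₁ A₂ b)) :=
  fun b => Bool.rec (motive := fun b => ↥(A₁ ⊓ A₂) →* ↥(amalgamFam A₁ A₂ b))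
    (Subgroup.inclusion inf_le_left) (Subgroup.inclusion inf_le_right) b

/-- The canonical homomorphism from the amalgamated free product
`A₁ *_{A₁ ⊓ A₂} A₂` (Mathlib's `Monoid.PushoutI` of the two inclusions) to `G`,
induced by the inclusions of `A₁` and `A₂` into `G`. -/
def amalgamLift {G : Type*} [Group G] (A₁ A₂ : Subgroup G) :
    Monoid.PushoutI (amalgamIncl A₁ A₂) →* G :=
  Monoid.PushoutI.lift
    (fun b => Bool.rec (motive := fun b => ↥(amalgamFam A₁ A₂ b) →* G)
      A₁.subtype A₂.subtype b)
    (A₁ ⊓ A₂).subtype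
    (by rintro (_ | _) <;> rfl)

open Monoid

/-- In a tree, a vertex has at most one neighbour that is closer to a given vertex. -/
theorem SimpleGraph.IsTree.eq_of_adj_of_dist_eq_add_one {V : Type*} {X : SimpleGraph V}
    (hX : X.IsTree) {v x y z : V} (hy : X.Adj y x) (hz : X.Adj z x)
    (hdy : X.dist v x = X.dist v y + 1) (hdz : X.dist v x = X.dist v z + 1) : y = z := by
  obtain ⟨p, hp⟩ := hX.connected.exists_walk_length_eq_dist v y
  obtain ⟨q, hq⟩ := hX.connected.exists_walk_length_eq_dist v z
  have hp' : (p.concat hy).IsPath :=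
    (p.concat hy).isPath_of_length_eq_dist (by rw [SimpleGraph.Walk.length_concat, hp, hdy])
  have hq' : (q.concat hz).IsPath :=
    (q.concat hz).isPath_of_length_eq_dist (by rw [SimpleGraph.Walk.length_concat, hq, hdz])
  have h := congrArg SimpleGraph.Walk.penultimate
    ((hX.existsUnique_path v x).unique hp' hq')
  simpa using h

section Action

variable {V G : Type*} [Group G] [MulAction G V] {X : SimpleGraph V}

theorem SimpleGraph.Connected.dist_smul_smul (hX : X.Connected)
    (hact : ∀ (g : G) (v w : V), X.Adj v w → X.Adj (g • v) (g • w)) (g : G) (v w : V) :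
    X.dist (g • v) (g • w) = X.dist v w := by
  have hle : ∀ (g : G) (v w : V), X.dist (g • v) (g • w) ≤ X.dist v w := fun g v w ↦ by
    obtain ⟨p, hp⟩ := hX.exists_walk_length_eq_dist v w
    have h := SimpleGraph.dist_le (p.map (⟨(g • ·), hact g _ _⟩ : X →g X))
    rwa [SimpleGraph.Walk.length_map, hp] at h
  refine (hle g v w).antisymm ?_
  simpa using hle g⁻¹ (g • v) (g • w)

/-- An automorphism of a tree fixing `x` and moving its neighbour `y` maps the half-tree beyond
`y` into the half-tree beyond `x`. -/
theorem SimpleGraph.IsTree.dist_smul_eq_dist_smul_add_one (hX : X.IsTree)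
    (hact : ∀ (g : G) (v w : V), X.Adj v w → X.Adj (g • v) (g • w)) {g : G} {x y v : V}
    (hxy : X.Adj x y) (hx : g • x = x) (hy : g • y ≠ y) (hv : X.dist v x = X.dist v y + 1) :
    X.dist (g • v) y = X.dist (g • v) x + 1 := by
  have hdist := hX.connected.dist_smul_smul hact g v
  have hgy : X.Adj (g • y) x := by simpa [hx] using (hact g x y hxy).symm
  refine (hX.dist_eq_dist_add_one_of_adj (g • v) hxy).resolve_left fun h ↦ hy ?_
  refine hX.eq_of_adj_of_dist_eq_add_one (v := g • v) hgy hxy.symm ?_ h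
  have hx' := hdist x
  rw [hx] at hx'
  rw [hdist y, hx', hv]

/-- If, for each `i`, the elements of `Γ` fixing `x i` move every neighbour of `x i` to `x (!i)`,
then `Γ` moves every edge of a connected graph onto the edge joining `x false` and `x true`. -/
theorem SimpleGraph.Connected.exists_smul_pair_eq (hX : X.Connected)
    (hact : ∀ (g : G) (v w : V), X.Adj v w → X.Adj (g • v) (g • w)) {x : Bool → V}
    (Γ : Subgroup G)
    (htrans : ∀ i v, X.Adj (x i) v → ∃ a ∈ Γ, a • x i = x i ∧ a • v = x (!i))
    {v w : V} (hvw : X.Adj v w) :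
    ∃ γ ∈ Γ, ∃ i, γ • v = x i ∧ γ • w = x (!i) := by
  have step : ∀ {v w : V}, X.Adj v w → (∃ γ ∈ Γ, ∃ i, γ • v = x i) →
      ∃ γ ∈ Γ, ∃ i, γ • v = x i ∧ γ • w = x (!i) := by
    rintro v w hvw ⟨γ, hγ, i, hi⟩
    obtain ⟨a, ha, hai, haw⟩ := htrans i (γ • w) (hi ▸ hact γ v w hvw)
    exact ⟨a * γ, Γ.mul_mem ha hγ, i, by rw [mul_smul, hi, hai], by rw [mul_smul, haw]⟩
  have orbit : ∀ {u v : V}, X.Walk u v → (∃ γ ∈ Γ, ∃ i, γ • u = x i) →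
      ∃ γ ∈ Γ, ∃ i, γ • v = x i := by
    intro u v p
    induction p with
    | nil => exact id
    | cons h _ ih =>
      intro hu
      obtain ⟨γ, hγ, i, -, hw⟩ := step h hu
      exact ih ⟨γ, hγ, !i, hw⟩
  obtain ⟨p⟩ := hX (x false) v
  exact step hvw (orbit p ⟨1, Γ.one_mem, false, one_smul _ _⟩)

end Action

namespace Monoid.PushoutI

variable {K : Bool → Type*} {H : Type*} [∀ i, Group (K i)] [Group H] {φ : ∀ i, H →* K i}

/-- `IsAlternating φ i l p` says that `p` is a nonempty product of letters taken alternately from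
`K false` and `K true`, none of them in the base group, the first one in `K i` and the last one
in `K l`. -/
inductive IsAlternating (φ : ∀ i, H →* K i) : Bool → Bool → PushoutI φ → Prop
  | single (i : Bool) (a : K i) (ha : a ∉ (φ i).range) : IsAlternating φ i i (of i a)
  | cons (i l : Bool) (a : K i) (ha : a ∉ (φ i).range) (p : PushoutI φ)
      (hp : IsAlternating φ (!i) l p) : IsAlternating φ i l (of i a * p)

theorem IsAlternating.of_mul {i l : Bool} {p : PushoutI φ} (hp : IsAlternating φ i l p)
    (b : K i) : (∃ h, of i b * p = base φ h) ∨ ∃ j, IsAlternating φ j l (of i b * p) := by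
  have base_mul : ∀ {j : Bool} {q : PushoutI φ}, IsAlternating φ j l q → ∀ h : H,
      IsAlternating φ j l (base φ h * q) := by
    intro j q hq h
    cases hq with
    | single _ a ha =>
      rw [← of_apply_eq_base φ l, ← map_mul]
      exact .single _ _ fun hm ↦ ha (((φ l).range.mul_mem_cancel_left ⟨h, rfl⟩).1 hm)
    | cons _ _ a ha q hq =>
      rw [← of_apply_eq_base φ j, ← mul_assoc, ← map_mul]
      exact .cons _ _ _ (fun hm ↦ ha (((φ j).range.mul_mem_cancel_left ⟨h, rfl⟩).1 hm)) _ hq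
  cases hp with
  | single _ a ha =>
    rw [← map_mul]
    by_cases hba : b * a ∈ (φ i).range
    · obtain ⟨h, hh⟩ := hba
      exact .inl ⟨h, by rw [← hh, of_apply_eq_base]⟩
    · exact .inr ⟨i, .single _ _ hba⟩
  | cons _ _ a ha q hq =>
    rw [← mul_assoc, ← map_mul]
    by_cases hba : b * a ∈ (φ i).range
    · obtain ⟨h, hh⟩ := hba
      rw [← hh, of_apply_eq_base]
      exact .inr ⟨!i, base_mul hq h⟩
    · exact .inr ⟨i, .cons _ _ _ hba _ hq⟩

theorem exists_eq_base_or_isAlternating (p : PushoutI φ) :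
    (∃ h, p = base φ h) ∨ ∃ i l, IsAlternating φ i l p := by
  have of_mul : ∀ (i : Bool) (b : K i) (q : PushoutI φ),
      ((∃ h, q = base φ h) ∨ ∃ i l, IsAlternating φ i l q) →
      (∃ h, of i b * q = base φ h) ∨ ∃ j l, IsAlternating φ j l (of i b * q) := by
    rintro i b q (⟨h, rfl⟩ | ⟨j, l, hq⟩)
    · rw [← of_apply_eq_base φ i, ← map_mul]
      by_cases hb : b * φ i h ∈ (φ i).range
      · obtain ⟨h', hh'⟩ := hb
        exact .inl ⟨h', by rw [← hh', of_apply_eq_base]⟩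
      · exact .inr ⟨i, i, .single _ _ hb⟩
    · by_cases hij : j = i
      · subst hij
        exact (hq.of_mul b).imp_right fun ⟨k, hk⟩ ↦ ⟨k, l, hk⟩
      · obtain rfl : j = !i := Bool.eq_not_iff.2 hij
        by_cases hb : b ∈ (φ i).range
        · obtain ⟨h, rfl⟩ := hb
          rw [of_apply_eq_base, ← of_apply_eq_base φ (!i)]
          exact (hq.of_mul _).imp_right fun ⟨k, hk⟩ ↦ ⟨k, l, hk⟩
        · exact .inr ⟨i, l, .cons _ _ _ hb _ hq⟩
  have mul : ∀ q : PushoutI φ, ((∃ h, q = base φ h) ∨ ∃ i l, IsAlternating φ i l q) →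
      (∃ h, p * q = base φ h) ∨ ∃ j l, IsAlternating φ j l (p * q) := by
    induction p using PushoutI.induction_on with
    | of i b => exact of_mul i b
    | base h =>
      rw [← of_apply_eq_base φ false]
      exact of_mul _ _
    | mul x y hx hy =>
      intro q hq
      rw [mul_assoc]
      exact hx _ (hy _ hq)
  simpa using mul 1 (.inl ⟨1, (map_one _).symm⟩)

theorem IsAlternating.exists_eq_mul_of {i l : Bool} {p : PushoutI φ}
    (hp : IsAlternating φ i l p) :
    ∃ (q : PushoutI φ) (a : K l), p = q * of l a ∧ (q = 1 ∧ i = l ∨ IsAlternating φ i (!l) q) := by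
  induction hp with
  | single i a ha => exact ⟨1, a, (one_mul _).symm, .inl ⟨rfl, rfl⟩⟩
  | cons i l a ha p hp ih =>
    obtain ⟨q, b, rfl, ⟨rfl, rfl⟩ | hq⟩ := ih
    · refine ⟨of i a, b, by rw [one_mul], .inr ?_⟩
      rw [Bool.not_not]
      exact .single i a ha
    · exact ⟨of i a * q, b, (mul_assoc _ _ _).symm, .inr (.cons _ _ _ ha _ hq)⟩

section Tree

variable {V G : Type*} [Group G] [MulAction G V] {X : SimpleGraph V} {f : PushoutI φ →* G}
  {x : Bool → V}

theorem IsAlternating.smul_mem_halfTree (hX : X.IsTree)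
    (hact : ∀ (g : G) (v w : V), X.Adj v w → X.Adj (g • v) (g • w))
    (hadj : ∀ i, X.Adj (x i) (x (!i))) (hfix : ∀ i (a : K i), f (of i a) • x i = x i)
    (hmove : ∀ i (a : K i), a ∉ (φ i).range → f (of i a) • x (!i) ≠ x (!i))
    {i l : Bool} {p : PushoutI φ} (hp : IsAlternating φ i l p) :
    f p • x (!l) ≠ x i ∧
      X.dist (f p • x (!l)) (x (!i)) = X.dist (f p • x (!l)) (x i) + 1 := by
  induction hp with
  | single i a ha =>
    refine ⟨fun h ↦ (hadj i).ne ?_, ?_⟩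
    · exact MulAction.injective (f (of i a)) ((hfix i a).trans h.symm)
    · refine hX.dist_smul_eq_dist_smul_add_one hact (hadj i) (hfix i a) (hmove i a ha) ?_
      rw [X.dist_self, SimpleGraph.dist_eq_one_iff_adj.2 (hadj i).symm]
  | cons i l a ha p hp ih =>
    rw [map_mul, mul_smul]
    rw [Bool.not_not] at ih
    refine ⟨fun h ↦ ?_, ?_⟩
    · have hx := MulAction.injective (f (of i a)) (h.trans (hfix i a).symm)
      have hd := ih.2
      rw [hx, X.dist_self] at hd
      exact absurd hd (Nat.succ_ne_zero _).symm
    · exact hX.dist_smul_eq_dist_smul_add_one hact (hadj i) (hfix i a) (hmove i a ha) ih.2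

theorem IsAlternating.smul_ne (hX : X.IsTree)
    (hact : ∀ (g : G) (v w : V), X.Adj v w → X.Adj (g • v) (g • w))
    (hadj : ∀ i, X.Adj (x i) (x (!i))) (hfix : ∀ i (a : K i), f (of i a) • x i = x i)
    (hmove : ∀ i (a : K i), a ∉ (φ i).range → f (of i a) • x (!i) ≠ x (!i))
    {i l : Bool} {p : PushoutI φ} (hp : IsAlternating φ i (!l) p) : f p • x l ≠ x l := by
  have h := hp.smul_mem_halfTree hX hact hadj hfix hmove
  rw [Bool.not_not] at h
  intro hl
  rw [hl] at h
  by_cases hil : i = l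
  · exact h.1 (hil ▸ rfl)
  · obtain rfl : i = !l := Bool.eq_not_iff.2 hil
    have hd := h.2
    rw [Bool.not_not, X.dist_self] at hd
    exact absurd hd (Nat.succ_ne_zero _).symm

theorem mem_range_of_of_smul_eq (hX : X.IsTree)
    (hact : ∀ (g : G) (v w : V), X.Adj v w → X.Adj (g • v) (g • w))
    (hadj : ∀ i, X.Adj (x i) (x (!i))) (hfix : ∀ i (a : K i), f (of i a) • x i = x i)
    (hmove : ∀ i (a : K i), a ∉ (φ i).range → f (of i a) • x (!i) ≠ x (!i))
    {p : PushoutI φ} {j : Bool} (hp : f p • x j = x j) :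
    p ∈ (of j : K j →* PushoutI φ).range := by
  obtain ⟨h, rfl⟩ | ⟨i, l, hil⟩ := exists_eq_base_or_isAlternating p
  · exact ⟨φ j h, of_apply_eq_base φ j h⟩
  by_cases hlj : l = j
  · subst hlj
    obtain ⟨q, a, rfl, ⟨rfl, -⟩ | hq⟩ := hil.exists_eq_mul_of
    · exact ⟨a, (one_mul _).symm⟩
    · rw [map_mul, mul_smul, hfix] at hp
      exact absurd hp (hq.smul_ne hX hact hadj hfix hmove)
  · obtain rfl : l = !j := Bool.eq_not_iff.2 hlj
    exact absurd hp (hil.smul_ne hX hact hadj hfix hmove)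

end Tree

end Monoid.PushoutI

theorem amalgamLift_of {G : Type*} [Group G] (A₁ A₂ : Subgroup G) (i : Bool)
    (a : amalgamFam A₁ A₂ i) :
    amalgamLift A₁ A₂ (PushoutI.of i a) = (a : G) := by
  rw [amalgamLift, PushoutI.lift_of]
  cases i <;> rfl

theorem amalgamLift_range {G : Type*} [Group G] (A₁ A₂ : Subgroup G) :
    (amalgamLift A₁ A₂).range = Subgroup.closure (↑A₁ ∪ ↑A₂ : Set G) := by
  apply le_antisymm
  · rintro _ ⟨p, rfl⟩
    have hof : ∀ i (a : amalgamFam A₁ A₂ i), amalgamLift A₁ A₂ (PushoutI.of i a) ∈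
        Subgroup.closure (↑A₁ ∪ ↑A₂ : Set G) := by
      intro i a
      rw [amalgamLift_of]
      cases i
      · exact Subgroup.subset_closure (.inl a.2)
      · exact Subgroup.subset_closure (.inr a.2)
    induction p using PushoutI.induction_on with
    | of i a => exact hof i a
    | base h =>
      rw [← PushoutI.of_apply_eq_base (amalgamIncl A₁ A₂) false]
      exact hof _ _
    | mul p q hp hq =>
      rw [map_mul]
      exact mul_mem hp hq
  · rw [Subgroup.closure_le]
    rintro a (ha | ha)
    · exact ⟨PushoutI.of false ⟨a, ha⟩, amalgamLift_of A₁ A₂ false ⟨a, ha⟩⟩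
    · exact ⟨PushoutI.of true ⟨a, ha⟩, amalgamLift_of A₁ A₂ true ⟨a, ha⟩⟩

/-- Let `X` be a tree on a vertex set `V`, let a group `G` act on `V` by
automorphisms of `X`, and let `x₁, x₂` be adjacent vertices.  For `i = 1, 2` let `A_i` be a
finite subgroup of the stabiliser of `x_i` acting transitively on the neighbours of `x_i`,
with `Stab_{A_i}(x_{3-i}) = A₁ ⊓ A₂`.  Then the subgroup `Γ` generated by `A₁ ∪ A₂` has
vertex stabilisers `A₁`, `A₂`, acts transitively on (unordered) edges with fundamental
edge `{x₁, x₂}`, and the canonical homomorphism `A₁ *_{A₁ ⊓ A₂} A₂ → G` is injective with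
image `Γ`. -/
theorem amalgam_of_edge_transitive_data
    {V G : Type*} [Group G] [MulAction G V]
    (X : SimpleGraph V) (hX : X.IsTree)
    (hact : ∀ (g : G) (v w : V), X.Adj v w → X.Adj (g • v) (g • w))
    (x₁ x₂ : V) (hadj : X.Adj x₁ x₂)
    (A₁ A₂ : Subgroup G) (hfin₁ : Finite A₁) (hfin₂ : Finite A₂)
    (hA₁ : A₁ ≤ MulAction.stabilizer G x₁) (hA₂ : A₂ ≤ MulAction.stabilizer G x₂)
    (htrans₁ : ∀ v w : V, X.Adj x₁ v → X.Adj x₁ w → ∃ a ∈ A₁, a • v = w)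
    (htrans₂ : ∀ v w : V, X.Adj x₂ v → X.Adj x₂ w → ∃ a ∈ A₂, a • v = w)
    (hstab₁ : A₁ ⊓ MulAction.stabilizer G x₂ = A₁ ⊓ A₂)
    (hstab₂ : A₂ ⊓ MulAction.stabilizer G x₁ = A₁ ⊓ A₂) :
    Subgroup.closure (↑A₁ ∪ ↑A₂ : Set G) ⊓ MulAction.stabilizer G x₁ = A₁ ∧
    Subgroup.closure (↑A₁ ∪ ↑A₂ : Set G) ⊓ MulAction.stabilizer G x₂ = A₂ ∧
    (∀ v w : V, X.Adj v w → ∃ γ ∈ Subgroup.closure (↑A₁ ∪ ↑A₂ : Set G),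
      ({γ • v, γ • w} : Set V) = {x₁, x₂}) ∧
    Function.Injective (amalgamLift A₁ A₂) ∧
    (amalgamLift A₁ A₂).range = Subgroup.closure (↑A₁ ∪ ↑A₂ : Set G) := by
  have hadj' : ∀ i : Bool, X.Adj (bif i then x₂ else x₁) (bif !i then x₂ else x₁) := by
    rintro (_ | _)
    exacts [hadj, hadj.symm]
  have hfix : ∀ i (a : amalgamFam A₁ A₂ i),
      amalgamLift A₁ A₂ (PushoutI.of i a) • (bif i then x₂ else x₁) =
        bif i then x₂ else x₁ := by
    intro i a
    rw [amalgamLift_of]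
    cases i
    exacts [hA₁ a.2, hA₂ a.2]
  have hmove : ∀ i (a : amalgamFam A₁ A₂ i), a ∉ (amalgamIncl A₁ A₂ i).range →
      amalgamLift A₁ A₂ (PushoutI.of i a) • (bif !i then x₂ else x₁) ≠
        bif !i then x₂ else x₁ := by
    intro i a ha h
    rw [amalgamLift_of] at h
    cases i
    · exact ha ⟨⟨a, hstab₁.le ⟨a.2, h⟩⟩, rfl⟩
    · exact ha ⟨⟨a, hstab₂.le ⟨a.2, h⟩⟩, rfl⟩
  have hmem : ∀ (i : Bool) (p : PushoutI (amalgamIncl A₁ A₂)),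
      amalgamLift A₁ A₂ p • (bif i then x₂ else x₁) = (bif i then x₂ else x₁) →
      ∃ a : amalgamFam A₁ A₂ i, PushoutI.of i a = p :=
    fun i p hp ↦ PushoutI.mem_range_of_of_smul_eq (x := fun i ↦ bif i then x₂ else x₁)
      hX hact hadj' hfix hmove hp
  have hle₁ : A₁ ≤ Subgroup.closure (↑A₁ ∪ ↑A₂ : Set G) :=
    fun a ha ↦ Subgroup.subset_closure (.inl ha)
  have hle₂ : A₂ ≤ Subgroup.closure (↑A₁ ∪ ↑A₂ : Set G) :=
    fun a ha ↦ Subgroup.subset_closure (.inr ha)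
  refine ⟨le_antisymm ?_ (le_inf hle₁ hA₁), le_antisymm ?_ (le_inf hle₂ hA₂), ?_, ?_,
    amalgamLift_range A₁ A₂⟩
  · rw [← amalgamLift_range]
    rintro _ ⟨⟨p, rfl⟩, hp⟩
    obtain ⟨a, rfl⟩ := hmem false p hp
    rw [amalgamLift_of]
    exact a.2
  · rw [← amalgamLift_range]
    rintro _ ⟨⟨p, rfl⟩, hp⟩
    obtain ⟨a, rfl⟩ := hmem true p hp
    rw [amalgamLift_of]
    exact a.2
  · intro v w hvw
    obtain ⟨γ, hγ, i, hv, hw⟩ := hX.connected.exists_smul_pair_eq hact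
      (x := fun i ↦ bif i then x₂ else x₁) (Subgroup.closure (↑A₁ ∪ ↑A₂ : Set G))
      (by
        rintro (_ | _) v hv
        · obtain ⟨a, ha, hav⟩ := htrans₁ v x₂ hv hadj
          exact ⟨a, hle₁ ha, hA₁ ha, hav⟩
        · obtain ⟨a, ha, hav⟩ := htrans₂ v x₁ hv hadj.symm
          exact ⟨a, hle₂ ha, hA₂ ha, hav⟩) hvw
    refine ⟨γ, hγ, ?_⟩
    rw [hv, hw]
    cases i
    exacts [rfl, Set.pair_comm _ _]
  · rw [injective_iff_map_eq_one]
    intro p hp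
    obtain ⟨a, rfl⟩ := hmem false p (by rw [hp, one_smul])
    rw [amalgamLift_of] at hp
    obtain rfl : a = 1 := Subtype.ext hp
    exact map_one _
end

section
/- Let q = 2^a with a ≥ 1, and let A be a proper subgroup of SL₂(𝔽_q) such that q+1 divides the order of A. Then either A is cyclic of order q+1, or A is isomorphic to the dihedral group of order 2(q+1). -/
open Matrix OnePoint

section OrbitCounting

variable {G X : Type*} [Group G] [MulAction G X]

lemma MulAction.card_orbit_mul_card_stabilizer (x : X) :
    Nat.card (orbit G x) * Nat.card (stabilizer G x) = Nat.card G := by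
  rw [← Nat.card_prod, Nat.card_congr (orbitProdStabilizerEquivGroup G x)]

lemma MulAction.card_orbit_pos [Finite G] (x : X) : 0 < Nat.card (orbit G x) := by
  refine Nat.pos_of_mul_pos_right (b := Nat.card (stabilizer G x)) ?_
  rw [card_orbit_mul_card_stabilizer]
  exact Nat.card_pos

/-- Splitting off the orbit of a point with nontrivial stabilizer from a sum of orders of
stabilizers. -/
lemma MulAction.exists_split_orbit [Finite G] (s : Finset X) (hs : ∀ x ∈ s, ∀ g : G, g • x ∈ s)
    (h0 : 0 < ∑ x ∈ s, (Nat.card (stabilizer G x) - 1)) :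
    ∃ z ∈ s, ∃ s' ⊆ s, (∀ x ∈ s', ∀ g : G, g • x ∈ s') ∧ 1 < Nat.card (stabilizer G z) ∧
      ∑ x ∈ s, (Nat.card (stabilizer G x) - 1) + Nat.card (orbit G z) =
        Nat.card G + ∑ x ∈ s', (Nat.card (stabilizer G x) - 1) := by
  classical
  obtain ⟨z, hz, hz1⟩ := Finset.exists_ne_zero_of_sum_ne_zero h0.ne'
  refine ⟨z, hz, s.filter (· ∉ orbit G z), Finset.filter_subset _ _, ?_, by omega, ?_⟩
  · intro x hx g
    rw [Finset.mem_filter] at hx ⊢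
    refine ⟨hs x hx.1 g, ?_⟩
    rw [← orbit_eq_iff, orbit_smul, orbit_eq_iff]
    exact hx.2
  · have horb : ((s.filter (· ∈ orbit G z) : Finset X) : Set X) = orbit G z := by
      ext x
      simp only [Finset.coe_filter, Set.mem_ofPred_eq, and_iff_right_iff_imp]
      rintro ⟨g, rfl⟩
      exact hs z hz g
    have hcard : Nat.card (orbit G z) = (s.filter (· ∈ orbit G z)).card := by
      rw [Nat.card_coe_set_eq, ← Set.ncard_coe_finset, horb]
    have hsum : ∑ x ∈ s with x ∈ orbit G z, (Nat.card (stabilizer G x) - 1) =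
        Nat.card (orbit G z) * (Nat.card (stabilizer G z) - 1) := by
      rw [hcard, ← smul_eq_mul]
      refine Finset.sum_const_nat (fun x hx ↦ ?_)
      have hx := (Finset.mem_filter.1 hx).2
      have h1 := card_orbit_mul_card_stabilizer (G := G) x
      have h2 := card_orbit_mul_card_stabilizer (G := G) z
      rw [orbit_eq_iff.2 hx, ← h2] at h1
      rw [Nat.eq_of_mul_eq_mul_left (card_orbit_pos z) h1]
    rw [← Finset.sum_filter_add_sum_filter_not s (· ∈ orbit G z), hsum,
      ← card_orbit_mul_card_stabilizer (G := G) z, Nat.mul_sub]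
    have := Nat.le_mul_of_pos_right (Nat.card (orbit G z)) (Nat.card_pos (α := stabilizer G z))
    omega

/-- The numerical case analysis: `u * d` is the order of a point stabilizer on the projective line,
and `s` consists of the points which are not rational. -/
lemma MulAction.exists_card_stabilizer_eq [Finite G] {a u d : ℕ} (ha : 1 ≤ a) (s : Finset X)
    (hs : ∀ x ∈ s, ∀ g : G, g • x ∈ s)
    (hdvd : ∀ x ∈ s, Nat.card (stabilizer G x) ∣ 2 ^ a + 1)
    (hu : u ∣ 2 ^ a) (hd : d ∣ 2 ^ a - 1) (hG : Nat.card G = (2 ^ a + 1) * (u * d))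
    (hsum : ∑ x ∈ s, (Nat.card (stabilizer G x) - 1) + (2 ^ a + 1) * u =
      Nat.card G + 2 * 2 ^ a) :
    (∃ x ∈ s, Nat.card (stabilizer G x) = 2 ^ a + 1 ∧ (u = 1 ∧ d = 1 ∨ u = 2 ∧ d = 1)) ∨
      u = 2 ^ a ∧ d = 2 ^ a - 1 := by
  have hq2 : 2 ∣ 2 ^ a := dvd_pow_self 2 (by omega)
  have hu2 : u = 1 ∨ u = 2 ∨ 4 ≤ u := by
    obtain ⟨k, -, rfl⟩ := (Nat.dvd_prime_pow Nat.prime_two).1 hu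
    rcases k with _ | _ | k
    · simp
    · simp
    · right; right
      rw [pow_add]
      have := Nat.one_le_two_pow (n := k)
      omega
  have hq0 : 0 < 2 ^ a := by positivity
  generalize 2 ^ a = q at *
  have hd0 : 0 < d := Nat.pos_of_dvd_of_pos hd (by omega)
  have hnu : (q + 1) * u ≤ Nat.card G := by
    rw [hG]
    exact Nat.mul_le_mul_left _ (Nat.le_mul_of_pos_right u hd0)
  obtain ⟨z, hz, s', hss, hs', hz1, hsum'⟩ := exists_split_orbit s hs (by omega)
  have hoz := card_orbit_mul_card_stabilizer (G := G) z
  have hthree {x : X} (hx : x ∈ s) (h1 : 1 < Nat.card (stabilizer G x)) :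
      3 * Nat.card (orbit G x) ≤ Nat.card G := by
    rw [← card_orbit_mul_card_stabilizer (G := G) x, mul_comm]
    refine Nat.mul_le_mul_left _ ?_
    have : Nat.card (stabilizer G x) ≠ 2 := by
      intro h
      have := hdvd x hx
      rw [h] at this
      omega
    omega
  have hz3 := hthree hz hz1
  by_cases hu1 : u = 1
  · subst hu1
    rw [one_mul] at hG
    left
    refine ⟨z, hz, ?_⟩
    obtain ⟨z', hz', s'', hss', hs'', hz1', hsum''⟩ := exists_split_orbit s' hs' (by omega)
    have hz3' := hthree (hss hz') hz1'
    have hrest : ∑ x ∈ s'', (Nat.card (stabilizer G x) - 1) = 0 := by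
      by_contra h
      obtain ⟨w, hw, _, _, _, hw1, hsum3⟩ := exists_split_orbit s'' hs'' (by omega)
      have := hthree (hss (hss' hw)) hw1
      omega
    have hd1 : d = 1 := by
      by_contra h
      have hd3 : 3 ≤ d := by
        have : d ≠ 2 := by rintro rfl; omega
        omega
      have := Nat.mul_le_mul_left (q + 1) hd3
      omega
    subst hd1
    have ho := card_orbit_pos (G := G) z
    have ho' := card_orbit_pos (G := G) z'
    have : Nat.card (orbit G z) = 1 := by omega
    rw [this] at hoz
    exact ⟨by omega, by simp⟩
  · have hrest : ∑ x ∈ s', (Nat.card (stabilizer G x) - 1) = 0 := by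
      by_contra h
      obtain ⟨w, hw, _, _, _, hw1, hsum2⟩ := exists_split_orbit s' hs' (by omega)
      have := hthree (hss hw) hw1
      have : (q + 1) * 2 ≤ (q + 1) * u := Nat.mul_le_mul_left _ (by omega)
      omega
    obtain ⟨e, he⟩ := hdvd z hz
    have hoe : Nat.card (orbit G z) = e * (u * d) := by
      rw [hG, he] at hoz
      refine Nat.eq_of_mul_eq_mul_right (Nat.card_pos (α := stabilizer G z)) ?_
      linarith
    have hkey : e * (u * d) + 2 * q = (q + 1) * u := by omega
    have he1 : e = 1 := by
      have hcop : Nat.Coprime (q + 1) (2 * q) := by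
        refine Nat.Coprime.mul_right ?_ (by simp)
        rw [Nat.coprime_two_right, Nat.odd_iff]
        omega
      refine Nat.eq_one_of_dvd_coprimes hcop (Dvd.intro_left _ he.symm) ?_
      refine (Nat.dvd_add_right (Nat.dvd_mul_right e (u * d))).1 ?_
      rw [hkey]
      exact (Dvd.intro_left _ he.symm).mul_right u
    subst he1
    rcases hu2 with h | rfl | h4
    · omega
    · exact Or.inl ⟨z, hz, by omega, Or.inr ⟨rfl, by omega⟩⟩
    · right
      obtain ⟨v, rfl⟩ := hu
      have hdv : d + 2 * v = u * v + 1 := by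
        refine Nat.eq_of_mul_eq_mul_left (show 0 < u by omega) ?_
        linarith
      obtain ⟨k, hk⟩ := hd
      have h4v := Nat.mul_le_mul_right v h4
      have hk1 : k = 1 := by
        have hk0 : k ≠ 0 := by rintro rfl; omega
        by_contra hk1
        have := Nat.mul_le_mul_left d (show 2 ≤ k by omega)
        omega
      subst hk1
      have : v = 1 := by omega
      subst this
      omega

end OrbitCounting

/-- A group of order `2 * N` with a cyclic subgroup of order `N`, all of whose other elements are
involutions, is dihedral. -/
lemma DihedralGroup.nonempty_mulEquiv_of_isCyclic {G : Type*} [Group G] {N : ℕ} (hN : 0 < N)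
    (hG : Nat.card G = 2 * N) (T : Subgroup G) [IsCyclic T] (hT : Nat.card T = N)
    (hinv : ∀ g ∉ T, g * g = 1) : Nonempty (G ≃* DihedralGroup N) := by
  have : NeZero N := ⟨hN.ne'⟩
  have : Finite G := Nat.finite_of_card_ne_zero (by omega)
  obtain ⟨w, hw⟩ : ∃ w, w ∉ T := by
    by_contra! h
    rw [← Subgroup.eq_top_iff'] at h
    rw [h, Subgroup.card_top] at hT
    omega
  subst hT
  let φ : Multiplicative (ZMod (Nat.card T)) ≃* T := zmodCyclicMulEquiv inferInstance
  let t (i : ZMod (Nat.card T)) : G := φ (.ofAdd i)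
  have ht_mem (i) : t i ∈ T := SetLike.coe_mem _
  have ht_add (i j) : t (i + j) = t i * t j := by simp [t, ofAdd_add]
  have ht_zero : t 0 = 1 := by simp [t]
  have ht_inj : Function.Injective t :=
    Subtype.val_injective.comp (φ.injective.comp Multiplicative.ofAdd.injective)
  have hwt (i) : w * t i ∉ T := by rwa [T.mul_mem_cancel_right (ht_mem i)]
  have hww : w * w = 1 := hinv w hw
  have htw (i) : t i * w = w * t (-i) := by
    have h1 := hinv _ (hwt i)
    have h2 : t i * t (-i) = 1 := by rw [← ht_add, add_neg_cancel, ht_zero]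
    calc t i * w = (w * w) * (t i * w) * (t i * t (-i)) := by rw [hww, h2, one_mul, mul_one]
      _ = w * ((w * t i) * (w * t i)) * t (-i) := by group
      _ = w * t (-i) := by rw [h1, mul_one]
  let f : DihedralGroup (Nat.card T) →* G :=
    { toFun
        | .r i => t i
        | .sr i => w * t i
      map_one' := ht_zero
      map_mul' := by
        rintro (i | i) (j | j)
        · exact ht_add i j
        · change w * t (j - i) = t i * (w * t j)
          rw [← mul_assoc, htw, mul_assoc, ← ht_add, neg_add_eq_sub]
        · change w * t (i + j) = w * t i * t j
          rw [ht_add, mul_assoc]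
        · change t (j - i) = w * t i * (w * t j)
          rw [mul_assoc w, ← mul_assoc (t i), htw, mul_assoc w, ← ht_add, ← mul_assoc, hww,
            one_mul, neg_add_eq_sub] }
  have hf : Function.Injective f := by
    rintro (i | i) (j | j) h
    · exact congrArg _ (ht_inj h)
    · exact (hwt j ((show t i = w * t j from h) ▸ ht_mem i)).elim
    · exact (hwt i ((show w * t i = t j from h) ▸ ht_mem j)).elim
    · exact congrArg _ (ht_inj (mul_left_cancel h))
  have hbij : Function.Bijective f :=
    (Nat.bijective_iff_injective_and_card f).2 ⟨hf, by rw [hG, DihedralGroup.nat_card]⟩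
  exact ⟨(MulEquiv.ofBijective f hbij).symm⟩
section ProjectiveLine

variable {F K : Type*} [Field F] [Field K] [Algebra F K]

/-- An element of a field extension of a finite field `F` is fixed by the Frobenius of `F` only if
it lies in `F`. -/
lemma FiniteField.mem_range_algebraMap_of_pow_card_eq [Finite F] {z : K}
    (hz : z ^ Nat.card F = z) : z ∈ Set.range (algebraMap F K) := by
  have := Fintype.ofFinite F
  have hs : (Polynomial.X ^ Fintype.card F - Polynomial.X : Polynomial F).Splits := by
    simpa using (FiniteField.isSplittingField_sub F F).splits
  refine hs.mem_range_of_isRoot ?_ (x := z) ?_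
  · exact FiniteField.X_pow_card_sub_X_ne_zero _ Fintype.one_lt_card
  · simpa [sub_eq_zero, Nat.card_eq_fintype_card] using hz

/-- A monic quadratic over a finite field `F` has a root in the quadratic extension of `F`. -/
lemma FiniteField.exists_root_of_quadratic [Finite K] (hK : Module.finrank F K = 2) (b c : F) :
    ∃ z : K, z ^ 2 + algebraMap F K b * z + algebraMap F K c = 0 := by
  have : Finite F := Finite.of_injective _ (algebraMap F K).injective
  let p : Polynomial F := .X ^ 2 + .C b * .X + .C c
  have hdeg : p.natDegree = 2 := by simp only [p]; compute_degree!
  have hp0 : p ≠ 0 := by rintro h; simp [h] at hdeg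
  by_cases h : ∃ x, p.IsRoot x
  · obtain ⟨x, hx⟩ := h
    refine ⟨algebraMap F K x, ?_⟩
    have := congrArg (algebraMap F K) hx
    simpa [p] using this
  · push Not at h
    have hirr : Irreducible p :=
      Polynomial.irreducible_of_degree_le_three_of_not_isRoot (by simp [hdeg]) h
    have := Fact.mk hirr
    have hfin : Module.finrank F (AdjoinRoot p) = 2 := by
      rw [(AdjoinRoot.powerBasis hp0).finrank, AdjoinRoot.powerBasis_dim, hdeg]
    obtain ⟨f⟩ := nonempty_algHom_of_finrank_dvd (F := F) (K := AdjoinRoot p) (L := K)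
      (by rw [hfin, hK])
    refine ⟨f (AdjoinRoot.root p), ?_⟩
    have h0 := AdjoinRoot.aeval_algHom_eq_zero p f
    simp only [p, map_add, map_mul, map_pow, Polynomial.aeval_X, Polynomial.aeval_C] at h0
    exact h0

variable (F K) in
/-- The `F`-rational points of the projective line over an extension `K` of `F`. -/
def OnePoint.rationalPoints : Set (OnePoint K) := Set.range (OnePoint.map (algebraMap F K))

lemma OnePoint.infty_mem_rationalPoints : ∞ ∈ rationalPoints F K := ⟨∞, rfl⟩

lemma OnePoint.coe_mem_rationalPoints_iff {z : K} :
    (z : OnePoint K) ∈ rationalPoints F K ↔ z ∈ Set.range (algebraMap F K) := by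
  constructor
  · rintro ⟨_ | y, hy⟩
    · exact (infty_ne_coe _ hy).elim
    · exact ⟨y, OnePoint.coe_injective hy⟩
  · rintro ⟨y, rfl⟩
    exact ⟨y, rfl⟩

lemma OnePoint.ncard_rationalPoints [Finite F] :
    (rationalPoints F K).ncard = Nat.card F + 1 := by
  rw [rationalPoints, Set.ncard_range_of_injective]
  · exact Finite.card_option
  · exact Option.map_injective (algebraMap F K).injective

lemma OnePoint.finite_rationalPoints [Finite F] : (rationalPoints F K).Finite :=
  Set.finite_of_ncard_pos (by rw [ncard_rationalPoints]; omega)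

variable [DecidableEq K]

noncomputable instance OnePoint.instSLAction :
    MulAction (SpecialLinearGroup (Fin 2) F) (OnePoint K) :=
  MulAction.compHom _ (SpecialLinearGroup.mapGL K)

lemma OnePoint.sl_smul_def (g : SpecialLinearGroup (Fin 2) F) (x : OnePoint K) :
    g • x = SpecialLinearGroup.mapGL K g • x := rfl

lemma OnePoint.sl_smul_infty_eq_self_iff {g : SpecialLinearGroup (Fin 2) F} :
    g • (∞ : OnePoint K) = ∞ ↔ g 1 0 = 0 := by
  simp [sl_smul_def, smul_infty_eq_self_iff]

lemma OnePoint.sl_smul_coe_eq_self_iff {g : SpecialLinearGroup (Fin 2) F} {z : K} :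
    g • (z : OnePoint K) = z ↔ algebraMap F K (g 0 0) * z + algebraMap F K (g 0 1) =
      z * (algebraMap F K (g 1 0) * z + algebraMap F K (g 1 1)) := by
  rw [sl_smul_def, ← GeneralLinearGroup.fixpointPolynomial_aeval_eq_zero_iff]
  simp [GeneralLinearGroup.fixpointPolynomial]
  grind

lemma OnePoint.smul_mem_rationalPoints_iff {g : SpecialLinearGroup (Fin 2) F} {x : OnePoint K} :
    g • x ∈ rationalPoints F K ↔ x ∈ rationalPoints F K := by
  have key (g : SpecialLinearGroup (Fin 2) F) (x : OnePoint K) (hx : x ∈ rationalPoints F K) :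
      g • x ∈ rationalPoints F K := by
    classical
    obtain ⟨y, rfl⟩ := hx
    exact ⟨(SpecialLinearGroup.toGL g) • y, OnePoint.map_smul (algebraMap F K) _ y⟩
  exact ⟨fun h ↦ by simpa using key g⁻¹ _ h, key g x⟩

/-- In characteristic two, a nontrivial element of trace zero fixes exactly one point of the
projective line, and this point is rational. -/
lemma OnePoint.exists_smul_eq_iff_of_trace_eq_zero [Finite F] [CharP F 2]
    {g : SpecialLinearGroup (Fin 2) F} (hg : g ≠ 1) (ht : g.1.trace = 0) :
    ∃ y ∈ rationalPoints F K, ∀ x : OnePoint K, g • x = x ↔ x = y := by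
  have : CharP K 2 := charP_of_injective_algebraMap (algebraMap F K).injective 2
  have h2 : (2 : F) = 0 := CharTwo.two_eq_zero
  have h2' : (2 : K) = 0 := CharTwo.two_eq_zero
  have hdet := g.det_coe
  rw [det_fin_two] at hdet
  rw [trace_fin_two] at ht
  have had : g 1 1 = g 0 0 := by grind
  by_cases hc : g 1 0 = 0
  · refine ⟨∞, infty_mem_rationalPoints, fun x ↦ ?_⟩
    have ha : g 0 0 = 1 := by
      have : (g 0 0 - 1) ^ 2 = 0 := by grind
      grind
    induction x using OnePoint.rec with
    | infty => simpa [sl_smul_infty_eq_self_iff]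
    | coe z =>
      simp only [sl_smul_coe_eq_self_iff, coe_ne_infty, iff_false]
      intro h
      have hb : g 0 1 = 0 := by
        apply (algebraMap F K).injective
        simp only [hc, had, map_zero] at h ⊢
        linear_combination h
      apply hg
      ext i j
      fin_cases i <;> fin_cases j <;> simp [ha, hb, hc, had]
  · obtain ⟨s, hs⟩ := (PerfectRing.bijective_frobenius (R := F) (p := 2)).2 (g 0 1 / g 1 0)
    have hs : s ^ 2 * g 1 0 = g 0 1 := by
      exact (eq_div_iff hc).1 hs
    refine ⟨(algebraMap F K s : K), coe_mem_rationalPoints_iff.2 ⟨s, rfl⟩, fun x ↦ ?_⟩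
    induction x using OnePoint.rec with
    | infty => simpa [sl_smul_infty_eq_self_iff] using hc
    | coe z =>
      simp only [sl_smul_coe_eq_self_iff, OnePoint.coe_eq_coe, had, ← hs, map_mul, map_pow]
      have hc' : algebraMap F K (g 1 0) ≠ 0 := by simpa using hc
      constructor
      · intro h
        have : (z - algebraMap F K s) ^ 2 = 0 := by
          apply mul_left_cancel₀ hc'
          grind
        grind
      · grind

/-- In characteristic two, an element of nonzero trace fixes exactly two points of the
projective line over the quadratic extension. -/
lemma OnePoint.exists_smul_eq_iff_of_trace_ne_zero [Finite K] [CharP F 2]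
    (hK : Module.finrank F K = 2)
    {g : SpecialLinearGroup (Fin 2) F} (ht : g.1.trace ≠ 0) :
    ∃ y z : OnePoint K, y ≠ z ∧ ∀ x : OnePoint K, g • x = x ↔ x = y ∨ x = z := by
  have : CharP K 2 := charP_of_injective_algebraMap (algebraMap F K).injective 2
  have h2' : (2 : K) = 0 := CharTwo.two_eq_zero
  have h2 : (2 : F) = 0 := CharTwo.two_eq_zero
  rw [trace_fin_two] at ht
  have had : algebraMap F K (g 1 1) - algebraMap F K (g 0 0) ≠ 0 := by
    rw [← map_sub, map_ne_zero]; grind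
  by_cases hc : g 1 0 = 0
  · refine ⟨∞, (algebraMap F K (g 0 1) / (algebraMap F K (g 1 1) - algebraMap F K (g 0 0)) : K),
      infty_ne_coe _, fun x ↦ ?_⟩
    induction x using OnePoint.rec with
    | infty => simpa [sl_smul_infty_eq_self_iff]
    | coe z =>
      simp only [sl_smul_coe_eq_self_iff, coe_ne_infty, false_or, OnePoint.coe_eq_coe, hc,
        eq_div_iff had, map_zero]
      grind
  · have hc' : algebraMap F K (g 1 0) ≠ 0 := by simpa using hc
    obtain ⟨z, hz⟩ := FiniteField.exists_root_of_quadratic hK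
      ((g 1 1 - g 0 0) / g 1 0) (- g 0 1 / g 1 0)
    simp only [map_div₀, map_sub, map_neg] at hz
    set r := (algebraMap F K (g 1 1) - algebraMap F K (g 0 0)) / algebraMap F K (g 1 0) with hr
    have hr0 : r ≠ 0 := div_ne_zero had hc'
    refine ⟨z, (z + r : K), by simpa [eq_comm] using hr0, fun x ↦ ?_⟩
    induction x using OnePoint.rec with
    | infty => simpa [sl_smul_infty_eq_self_iff] using hc
    | coe w =>
      simp only [sl_smul_coe_eq_self_iff, OnePoint.coe_eq_coe]
      have hrc : r * algebraMap F K (g 1 0) = algebraMap F K (g 1 1) - algebraMap F K (g 0 0) :=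
        div_mul_cancel₀ _ hc'
      have hb : algebraMap F K (g 0 1) = algebraMap F K (g 1 0) * (z ^ 2 + r * z) := by
        field_simp at hz
        grind
      have : (algebraMap F K (g 0 0) * w + algebraMap F K (g 0 1) =
          w * (algebraMap F K (g 1 0) * w + algebraMap F K (g 1 1))) ↔
          algebraMap F K (g 1 0) * ((w - z) * (w - (z + r))) = 0 := by
        grind
      rw [this]
      simp [hc', sub_eq_zero]

/-- The stabilizer of a point which is not rational is cyclic of order dividing `q + 1`. -/
lemma OnePoint.isCyclic_stabilizer_of_notMem_rationalPoints [Finite F]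
    (A : Subgroup (SpecialLinearGroup (Fin 2) F)) {x : OnePoint K}
    (hx : x ∉ rationalPoints F K) :
    IsCyclic (MulAction.stabilizer A x) ∧
      Nat.card (MulAction.stabilizer A x) ∣ Nat.card F + 1 := by
  induction x using OnePoint.rec with
  | infty => exact (hx infty_mem_rationalPoints).elim
  | coe z =>
  rw [coe_mem_rationalPoints_iff] at hx
  have hfix (g : MulAction.stabilizer A (z : OnePoint K)) :=
    sl_smul_coe_eq_self_iff.1 (MulAction.mem_stabilizer_iff.1 g.2)
  let j : MulAction.stabilizer A (z : OnePoint K) →* K :=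
    { toFun g := algebraMap F K (g.1.1 1 0) * z + algebraMap F K (g.1.1 1 1)
      map_one' := by simp
      map_mul' g h := by
        have := hfix h
        simp [mul_apply, Fin.sum_univ_two] at this ⊢
        linear_combination algebraMap F K (g.1.1 1 0) * this }
  have hj (g) : j g = algebraMap F K (g.1.1 1 0) * z + algebraMap F K (g.1.1 1 1) := rfl
  have hinj : Function.Injective j := by
    rw [injective_iff_map_eq_one]
    intro g hg
    have hfg := hfix g
    rw [hj] at hg
    have hc : g.1.1 1 0 = 0 := by
      by_contra hc
      have hc' : algebraMap F K (g.1.1 1 0) ≠ 0 := by simpa using hc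
      refine hx ⟨(1 - g.1.1 1 1) / g.1.1 1 0, ?_⟩
      rw [map_div₀, div_eq_iff hc', map_sub, map_one]
      linear_combination -hg
    have hd : g.1.1 1 1 = 1 := by
      apply (algebraMap F K).injective
      simpa [hc] using hg
    have hdet := g.1.1.det_coe
    rw [det_fin_two] at hdet
    have ha : g.1.1 0 0 = 1 := by simpa [hc, hd] using hdet
    have hb : g.1.1 0 1 = 0 := by
      apply (algebraMap F K).injective
      simpa [hc, hd, ha] using hfg
    ext i k
    fin_cases i <;> fin_cases k <;> simp [ha, hb, hc, hd]
  have hcyc : IsCyclic (MulAction.stabilizer A (z : OnePoint K)) :=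
    isCyclic_of_injective_ringHom j hinj
  refine ⟨hcyc, ?_⟩
  rw [← IsCyclic.exponent_eq_card]
  refine Monoid.exponent_dvd_of_forall_pow_eq_one fun g ↦ hinj ?_
  have := Fintype.ofFinite F
  have hfrob (a b : F) : (algebraMap F K a * z + algebraMap F K b) ^ Nat.card F =
      algebraMap F K a * z ^ Nat.card F + algebraMap F K b := by
    simp only [Nat.card_eq_fintype_card]
    have := map_add (FiniteField.frobeniusAlgHom F K) (algebraMap F K a * z) (algebraMap F K b)
    simpa [mul_pow, ← map_pow, FiniteField.pow_card] using this
  have hz : z ^ Nat.card F ≠ z := fun h ↦ hx (FiniteField.mem_range_algebraMap_of_pow_card_eq h)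
  have hfg := hfix g
  have hfg' := congrArg (· ^ Nat.card F) hfg
  simp only [mul_pow, hfrob] at hfg'
  have hdet := congrArg (algebraMap F K) g.1.1.det_coe
  rw [det_fin_two] at hdet
  simp only [map_sub, map_mul, map_one] at hdet
  rw [map_pow, map_one, hj, pow_succ, hfrob]
  apply mul_right_cancel₀ (sub_ne_zero.2 hz)
  set w := z ^ Nat.card F
  linear_combination (w - z) * hdet -
    (algebraMap F K (g.1.1 1 0) * z + algebraMap F K (g.1.1 1 1)) * hfg' +
    (algebraMap F K (g.1.1 1 0) * w + algebraMap F K (g.1.1 1 1)) * hfg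

variable (K) in
/-- The order of the stabilizer of `∞` is `u * d`, where `u ∣ q` counts the elements of trace zero
and `d ∣ q - 1`. -/
lemma OnePoint.card_stabilizer_infty [Finite F] [CharP F 2]
    (A : Subgroup (SpecialLinearGroup (Fin 2) F)) :
    ∃ d, d ∣ Nat.card F - 1 ∧
      Nat.card {g : A // g.1.1.trace = 0 ∧ g • (∞ : OnePoint K) = ∞} ∣ Nat.card F ∧
      Nat.card (MulAction.stabilizer A (∞ : OnePoint K)) =
        Nat.card {g : A // g.1.1.trace = 0 ∧ g • (∞ : OnePoint K) = ∞} * d := by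
  have hc (g : MulAction.stabilizer A (∞ : OnePoint K)) : g.1.1 1 0 = 0 :=
    sl_smul_infty_eq_self_iff.1 (MulAction.mem_stabilizer_iff.1 g.2)
  have hdet (g : MulAction.stabilizer A (∞ : OnePoint K)) : g.1.1 0 0 * g.1.1 1 1 = 1 := by
    have := g.1.1.det_coe
    rw [det_fin_two] at this
    simpa [hc g] using this
  have h2 : (2 : F) = 0 := CharTwo.two_eq_zero
  let χ : MulAction.stabilizer A (∞ : OnePoint K) →* Fˣ := MonoidHom.toHomUnits
    { toFun g := g.1.1 0 0
      map_one' := by simp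
      map_mul' g h := by simp [mul_apply, Fin.sum_univ_two, hc h] }
  have hker (g) : g ∈ χ.ker ↔ g.1.1.1.trace = 0 := by
    have h1 : g ∈ χ.ker ↔ g.1.1 0 0 = 1 := by
      rw [MonoidHom.mem_ker, Units.ext_iff]
      rfl
    have hd := hdet g
    have ht := trace_fin_two g.1.1.1
    change _ = g.1.1 0 0 + g.1.1 1 1 at ht
    rw [h1, ht]
    constructor
    · grind
    · intro h
      have : (g.1.1 0 0 - 1) ^ 2 = 0 := by grind
      grind
  have hcard : Nat.card {g : A // g.1.1.trace = 0 ∧ g • (∞ : OnePoint K) = ∞} =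
      Nat.card χ.ker :=
    Nat.card_congr
      { toFun g := ⟨⟨g.1, g.2.2⟩, (hker _).2 g.2.1⟩
        invFun g := ⟨g.1.1, (hker _).1 g.2, g.1.2⟩
        left_inv _ := rfl
        right_inv _ := rfl }
  rw [hcard]
  refine ⟨Nat.card χ.range, ?_, ?_, ?_⟩
  · rw [← Nat.card_units]
    exact Subgroup.card_subgroup_dvd_card _
  · have ha (g : χ.ker) : g.1.1.1 0 0 = 1 := Units.ext_iff.1 (MonoidHom.mem_ker.1 g.2)
    have hd (g : χ.ker) : g.1.1.1 1 1 = 1 := by simpa [ha] using hdet g.1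
    let ψ : χ.ker →* Multiplicative F :=
      { toFun g := .ofAdd (g.1.1.1 0 1)
        map_one' := by simp
        map_mul' g h := by
          simp [mul_apply, Fin.sum_univ_two, ha, hd, ← ofAdd_add, add_comm] }
    have hψ : Function.Injective ψ := by
      intro g h hgh
      have hb : g.1.1.1 0 1 = h.1.1.1 0 1 := Multiplicative.ofAdd.injective hgh
      ext i k
      fin_cases i <;> fin_cases k <;> simp [ha, hb, hc, hd]
    exact Subgroup.card_dvd_of_injective (H := Multiplicative F) ψ hψ
  · rw [← Subgroup.index_ker, Subgroup.card_mul_index]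


lemma OnePoint.orbit_infty_eq_rationalPoints [Finite F] [CharP F 2]
    (A : Subgroup (SpecialLinearGroup (Fin 2) F)) (hA : Nat.card F + 1 ∣ Nat.card A) :
    MulAction.orbit A (∞ : OnePoint K) = rationalPoints F K := by
  have hfin := finite_rationalPoints (F := F) (K := K)
  refine Set.eq_of_subset_of_ncard_le ?_ ?_ hfin
  · rintro _ ⟨g, rfl⟩
    exact smul_mem_rationalPoints_iff.2 infty_mem_rationalPoints
  · obtain ⟨d, hd, hu, hm⟩ := card_stabilizer_infty K A
    have := MulAction.card_orbit_pos (G := A) (∞ : OnePoint K)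
    rw [← MulAction.card_orbit_mul_card_stabilizer (G := A) (∞ : OnePoint K), hm] at hA
    rw [ncard_rationalPoints, ← Nat.card_coe_set_eq]
    refine Nat.le_of_dvd this (Nat.Coprime.dvd_of_dvd_mul_right (Nat.Coprime.mul_right ?_ ?_) hA)
    · exact Nat.Coprime.coprime_dvd_right hu (by simp)
    · refine Nat.Coprime.coprime_dvd_right hd ?_
      have := Fintype.ofFinite F
      have h2 : Even (Nat.card F) := by
        rw [Nat.card_eq_fintype_card, Nat.even_iff]
        exact FiniteField.even_card_of_char_two (ringChar.eq F 2)
      obtain ⟨k, hk⟩ := h2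
      have hpos : 0 < Nat.card F := Nat.card_pos
      have h : Nat.card F + 1 = 2 + (Nat.card F - 1) := by omega
      rw [h, Nat.coprime_add_self_left, Nat.coprime_two_left, Nat.odd_iff]
      omega

/-- The number of nontrivial elements of trace zero, when the group is transitive on rational
points. -/
lemma OnePoint.card_trace_eq_zero [Finite F] [CharP F 2]
    (A : Subgroup (SpecialLinearGroup (Fin 2) F))
    (hA : MulAction.orbit A (∞ : OnePoint K) = rationalPoints F K) :
    Nat.card {g : A // g ≠ 1 ∧ g.1.1.trace = 0} + (Nat.card F + 1) =
      (Nat.card F + 1) * Nat.card {g : A // g.1.1.trace = 0 ∧ g • (∞ : OnePoint K) = ∞} := by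
  classical
  have := Fintype.ofFinite A
  have h2 : (2 : F) = 0 := CharTwo.two_eq_zero
  have hfin := finite_rationalPoints (F := F) (K := K)
  have hconj (x) (hx : x ∈ rationalPoints F K) :
      (Finset.univ.filter fun g : A ↦ (g ≠ 1 ∧ g.1.1.trace = 0) ∧ g • x = x).card =
        (Finset.univ.filter fun g : A ↦
          (g ≠ 1 ∧ g.1.1.trace = 0) ∧ g • (∞ : OnePoint K) = ∞).card := by
    rw [← hA] at hx
    obtain ⟨h, rfl⟩ := hx
    refine (Finset.card_equiv (MulAut.conj h).toEquiv fun g ↦ ?_).symm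
    have ht : (h * g * h⁻¹).1.1.trace = g.1.1.trace := by
      have hh : (h⁻¹).1.1 * h.1.1 = 1 := congrArg (fun g : A ↦ g.1.1) (inv_mul_cancel h)
      change (h.1.1 * g.1.1 * (h⁻¹).1.1).trace = _
      rw [trace_mul_comm, ← mul_assoc, hh, one_mul]
    have hfix : (h * g * h⁻¹) • h • (∞ : OnePoint K) = h • ∞ ↔ g • (∞ : OnePoint K) = ∞ := by
      simp [mul_smul]
    change _ ↔ h * g * h⁻¹ ∈ _
    simp only [Finset.mem_filter, Finset.mem_univ, true_and, ht, ne_eq, conj_eq_one_iff]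
    exact and_congr_right' hfix.symm
  have hu : Nat.card {g : A // g.1.1.trace = 0 ∧ g • (∞ : OnePoint K) = ∞} =
      (Finset.univ.filter fun g : A ↦
          (g ≠ 1 ∧ g.1.1.trace = 0) ∧ g • (∞ : OnePoint K) = ∞).card + 1 := by
    rw [Nat.card_eq_fintype_card, Fintype.card_subtype,
      ← Finset.card_erase_add_one (a := (1 : A)) (by simp [trace_fin_two, one_add_one_eq_two, h2])]
    congr 2
    ext g
    simp [and_assoc]
  have hcount := Finset.sum_card_bipartiteAbove_eq_sum_card_bipartiteBelow
    (s := hfin.toFinset) (t := Finset.univ.filter fun g : A ↦ g ≠ 1 ∧ g.1.1.trace = 0)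
    (fun x g ↦ g • x = x)
  simp only [Finset.bipartiteAbove, Finset.bipartiteBelow, Finset.filter_filter] at hcount
  rw [Finset.sum_congr rfl fun x hx ↦ hconj x (hfin.mem_toFinset.1 hx), Finset.sum_const,
    ← Set.ncard_eq_toFinset_card _ hfin, ncard_rationalPoints, smul_eq_mul,
    Finset.sum_congr rfl (g := fun _ ↦ 1), ← Finset.card_eq_sum_ones] at hcount
  · rw [hu, mul_add, hcount, Nat.card_eq_fintype_card, Fintype.card_subtype, mul_one]
  · intro g hg
    obtain ⟨hg1, ht⟩ := (Finset.mem_filter.1 hg).2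
    obtain ⟨y, hy, hfix⟩ := exists_smul_eq_iff_of_trace_eq_zero (K := K) (g := g.1)
      (by simpa using hg1) ht
    rw [Finset.card_eq_one]
    refine ⟨y, ?_⟩
    ext x
    have : g • x = x ↔ x = y := hfix x
    simp only [Finset.mem_filter, this, Set.Finite.mem_toFinset, Finset.mem_singleton,
      and_iff_right_iff_imp]
    rintro rfl
    exact hy

/-- Double counting of the pairs `(g, x)` with `g ≠ 1` and `g • x = x`. -/
lemma OnePoint.sum_card_stabilizer [Finite F] [Finite K] [CharP F 2]
    (hK : Module.finrank F K = 2) (A : Subgroup (SpecialLinearGroup (Fin 2) F))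
    (hA : MulAction.orbit A (∞ : OnePoint K) = rationalPoints F K)
    {s : Finset (OnePoint K)} (hs : ∀ x, x ∈ s ↔ x ∉ rationalPoints F K) :
    ∑ x ∈ s, (Nat.card (MulAction.stabilizer A x) - 1) +
      (Nat.card F + 1) * Nat.card {g : A // g.1.1.trace = 0 ∧ g • (∞ : OnePoint K) = ∞} =
        Nat.card A + 2 * Nat.card F := by
  classical
  have := Fintype.ofFinite A
  have := Fintype.ofFinite K
  have hfin := finite_rationalPoints (F := F) (K := K)
  have hn := MulAction.card_orbit_mul_card_stabilizer (G := A) (∞ : OnePoint K)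
  rw [hA, Nat.card_coe_set_eq, ncard_rationalPoints] at hn
  have hrat : ∑ x ∈ sᶜ, (Nat.card (MulAction.stabilizer A x) - 1) + (Nat.card F + 1) =
      Nat.card A := by
    have hsc : sᶜ = hfin.toFinset := by ext x; simp [hs]
    have hst (x) (hx : x ∈ sᶜ) : Nat.card (MulAction.stabilizer A x) - 1 =
        Nat.card (MulAction.stabilizer A (∞ : OnePoint K)) - 1 := by
      have hx : x ∈ MulAction.orbit A (∞ : OnePoint K) := by
        rw [hA]; simpa [hs] using hx
      have h1 := MulAction.card_orbit_mul_card_stabilizer (G := A) x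
      rw [MulAction.orbit_eq_iff.2 hx, hA, Nat.card_coe_set_eq, ncard_rationalPoints, ← hn] at h1
      rw [Nat.eq_of_mul_eq_mul_left (Nat.succ_pos _) h1]
    rw [Finset.sum_congr rfl hst, Finset.sum_const, hsc, ← Set.ncard_eq_toFinset_card _ hfin,
      ncard_rationalPoints, smul_eq_mul, ← Nat.mul_succ, Nat.succ_eq_add_one,
      Nat.sub_add_cancel Nat.card_pos, hn]
  have hstab (x : OnePoint K) : Nat.card (MulAction.stabilizer A x) - 1 =
      ((Finset.univ.erase (1 : A)).filter fun g ↦ g • x = x).card := by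
    rw [Nat.card_eq_fintype_card, Fintype.card_subtype, Finset.filter_erase,
      Finset.card_erase_of_mem (by simp)]
    simp only [MulAction.mem_stabilizer_iff]
  have hfix (g : A) (hg : g ∈ Finset.univ.erase (1 : A)) :
      (Finset.univ.filter fun x : OnePoint K ↦ g • x = x).card +
        (if g.1.1.trace = 0 then 1 else 0) = 2 := by
    have hg1 : g.1 ≠ 1 := by simpa using hg
    split_ifs with ht
    · obtain ⟨y, -, hfix⟩ := exists_smul_eq_iff_of_trace_eq_zero (K := K) hg1 ht
      rw [Nat.add_right_cancel_iff (n := 1), Finset.card_eq_one]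
      exact ⟨y, Finset.ext fun x ↦ by simpa using! hfix x⟩
    · obtain ⟨y, z, hyz, hfix⟩ := exists_smul_eq_iff_of_trace_ne_zero hK ht
      rw [add_zero, Finset.card_eq_two]
      exact ⟨y, z, hyz, Finset.ext fun x ↦ by simpa using! hfix x⟩
  have hcount := Finset.sum_card_bipartiteAbove_eq_sum_card_bipartiteBelow
    (s := (Finset.univ : Finset (OnePoint K))) (t := Finset.univ.erase (1 : A))
    (fun x g ↦ g • x = x)
  simp only [Finset.bipartiteAbove, Finset.bipartiteBelow, ← hstab] at hcount
  have hsum := Finset.sum_congr rfl hfix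
  rw [Finset.sum_add_distrib, ← hcount, ← Finset.sum_add_sum_compl s, Finset.sum_const,
    Finset.card_erase_of_mem (Finset.mem_univ _), Finset.card_univ, smul_eq_mul,
    ← Finset.card_filter, ← Nat.card_eq_fintype_card] at hsum
  have htr := card_trace_eq_zero A hA
  have hI : Nat.card {g : A // g ≠ 1 ∧ g.1.1.trace = 0} =
      ((Finset.univ.erase (1 : A)).filter fun g ↦ g.1.1.trace = 0).card := by
    rw [Nat.card_eq_fintype_card, Fintype.card_subtype]
    congr 1
    ext g
    simp
  rw [hI] at htr
  have hpos : 0 < Nat.card A := Nat.card_pos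
  omega

end ProjectiveLine

/-- The case analysis behind the main theorem, over an arbitrary finite field of characteristic
two. -/
theorem Matrix.SpecialLinearGroup.isCyclic_or_nonempty_mulEquiv_dihedralGroup {F : Type*} [Field F]
    [Finite F] [CharP F 2] {a : ℕ} (ha : 1 ≤ a) (hF : Nat.card F = 2 ^ a)
    {A : Subgroup (SpecialLinearGroup (Fin 2) F)} (hA : A ≠ ⊤) (hdvd : 2 ^ a + 1 ∣ Nat.card A) :
    (IsCyclic A ∧ Nat.card A = 2 ^ a + 1) ∨ Nonempty (A ≃* DihedralGroup (2 ^ a + 1)) := by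
  classical
  let K := FiniteField.Extension F 2 2
  have hK : Module.finrank F K = 2 := FiniteField.finrank_extension F 2 2
  have := Fintype.ofFinite K
  have hAF : Nat.card F + 1 ∣ Nat.card A := hF ▸ hdvd
  have horb := orbit_infty_eq_rationalPoints (K := K) A hAF
  obtain ⟨d, hd, hu, hm⟩ := card_stabilizer_infty K A
  have hs (x : OnePoint K) : x ∈ Finset.univ.filter (· ∉ rationalPoints F K) ↔
      x ∉ rationalPoints F K := by simp
  have hsum := sum_card_stabilizer hK A horb hs
  have htr := card_trace_eq_zero A horb
  have hn := MulAction.card_orbit_mul_card_stabilizer (G := A) (∞ : OnePoint K)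
  rw [horb, Nat.card_coe_set_eq, ncard_rationalPoints, hm] at hn
  generalize hu' : Nat.card {g : A // g.1.1.trace = 0 ∧ g • (∞ : OnePoint K) = ∞} = u at *
  have hmain := MulAction.exists_card_stabilizer_eq ha
    (Finset.univ.filter fun x : OnePoint K ↦ x ∉ rationalPoints F K)
    (fun x hx (g : A) ↦ (hs _).2 (mt smul_mem_rationalPoints_iff.1 ((hs x).1 hx)))
    (fun x hx ↦ hF ▸ (isCyclic_stabilizer_of_notMem_rationalPoints A ((hs x).1 hx)).2)
    (hF ▸ hu) (hF ▸ hd) (by rw [← hF, hn]) (by rw [← hF, hsum])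
  rw [hF] at hn htr
  rcases hmain with ⟨z, hz, hzcard, hud⟩ | ⟨rfl, rfl⟩
  · have hcyc := (isCyclic_stabilizer_of_notMem_rationalPoints A ((hs z).1 hz)).1
    rcases hud with ⟨rfl, rfl⟩ | ⟨rfl, rfl⟩
    · rw [mul_one, mul_one] at hn
      have htop := Subgroup.eq_top_of_card_eq _ (hzcard.trans hn)
      rw [htop] at hcyc
      exact Or.inl ⟨Subgroup.topEquiv.isCyclic.1 hcyc, hn.symm⟩
    · right
      refine DihedralGroup.nonempty_mulEquiv_of_isCyclic (Nat.succ_pos _) (by rw [← hn]; ring)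
        (MulAction.stabilizer A z) hzcard fun g hg ↦ ?_
      have hsub : {g : A | g ≠ 1 ∧ g.1.1.trace = 0} ⊆
          (MulAction.stabilizer A z : Set A)ᶜ := by
        rintro g ⟨hg1, ht⟩ hgz
        obtain ⟨y, hy, hfix⟩ := exists_smul_eq_iff_of_trace_eq_zero (K := K) (g := g.1)
          (by simpa using hg1) ht
        exact (hs z).1 hz ((hfix z).1 hgz ▸ hy)
      have heq := Set.eq_of_subset_of_ncard_le hsub (by
        rw [Set.ncard_compl, ← Nat.card_coe_set_eq, ← Nat.card_coe_set_eq]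
        change _ - Nat.card (MulAction.stabilizer A z) ≤
          Nat.card {g : A // g ≠ 1 ∧ g.1.1.trace = 0}
        omega)
      have ht : g.1.1.trace = 0 := (heq.ge hg).2
      have hdet := g.1.det_coe
      rw [det_fin_two] at hdet
      rw [trace_fin_two] at ht
      have h2 : (2 : F) = 0 := CharTwo.two_eq_zero
      ext i j
      fin_cases i <;> fin_cases j <;> simp [mul_apply, Fin.sum_univ_two] <;> grind
  · refine (hA (Subgroup.eq_top_of_card_eq A (le_antisymm (Subgroup.card_le_card_group A) ?_))).elim
    set B : Subgroup (SpecialLinearGroup (Fin 2) F) := ⊤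
    have hBcard : Nat.card B = Nat.card (SpecialLinearGroup (Fin 2) F) := Subgroup.card_top
    have hdvd' := hAF.trans (Subgroup.card_subgroup_dvd_card A)
    rw [← hBcard] at hdvd' ⊢
    obtain ⟨d', hd', hu', hm'⟩ := card_stabilizer_infty K B
    rw [← MulAction.card_orbit_mul_card_stabilizer (G := B) (∞ : OnePoint K),
      orbit_infty_eq_rationalPoints _ hdvd', Nat.card_coe_set_eq, ncard_rationalPoints, hm', hF,
      ← hn]
    have hlt := Nat.one_lt_two_pow (n := a) (by omega)
    rw [hF] at hd' hu'
    gcongr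
    · exact Nat.le_of_dvd (by omega) hu'
    · exact Nat.le_of_dvd (by omega) hd'

/-- Let `q = 2^a` with `a ≥ 1`, and let `A` be a proper subgroup of
`SL₂(𝔽_q)` such that `q + 1` divides the order of `A`.  Then either `A` is cyclic of order
`q + 1`, or `A` is isomorphic to the dihedral group of order `2(q + 1)`. -/
theorem dickson_corollary_char_two (a : ℕ) (ha : 1 ≤ a)
    (A : Subgroup (Matrix.SpecialLinearGroup (Fin 2) (GaloisField 2 a)))
    (hA : A ≠ ⊤) (hdvd : 2 ^ a + 1 ∣ Nat.card A) :
    (IsCyclic A ∧ Nat.card A = 2 ^ a + 1) ∨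
    Nonempty (A ≃* DihedralGroup (2 ^ a + 1)) := by
  have hF : Nat.card (GaloisField 2 a) = 2 ^ a := GaloisField.card 2 a (by omega)
  exact SpecialLinearGroup.isCyclic_or_nonempty_mulEquiv_dihedralGroup ha hF hA hdvd
end
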